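/- Fix positive real constants σ and M. For r > 0, define a(r) = (1/2)·(√(1 + 8rσ²/M²) − 1), b(r) = (1−a(r))M/(2σ√r), and c(r) = (2σ√r·e^{−b(r)²})/(M√π) + φ(b(r)). Then the map r ↦ c(r) is strictly increasing on (0, ∞); in particular, with A = σ√r/M, ∂c/∂r = ((2A²+1)√(1+8A²) − (6A²+1))·e^{−b²}/(2√π·r·A·√(1+8A²)) > 0, which follows from ((2A²+1)√(1+8A²))² − (6A²+1)² = 32A⁶ > 0 for A > 0. -/

import Mathlib

/-- The Gauss error function `erf x = (2/√π) ∫₀ˣ e^{−t²} dt`. -/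
noncomputable def erf (x : ℝ) : ℝ :=
  (2 / Real.sqrt Real.pi) * ∫ t in (0:ℝ)..x, Real.exp (-t ^ 2)

theorem hasDerivAt_erf (x : ℝ) :
    HasDerivAt erf ((2 / Real.sqrt Real.pi) * Real.exp (-x ^ 2)) x := by
  have hcont : Continuous fun t : ℝ => Real.exp (-t ^ 2) := by fun_prop
  exact (hcont.integral_hasStrictDerivAt 0 x).hasDerivAt.const_mul _

/-- The boundary point `b` as a function of `A = σ√r/M`. -/
noncomputable def scaledBoundary (A : ℝ) : ℝ :=
  (3 - Real.sqrt (1 + 8 * A ^ 2)) / (4 * A)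

/-- The function `c` as a function of `A = σ√r/M`. -/
noncomputable def scaledValue (A : ℝ) : ℝ :=
  2 / Real.sqrt Real.pi * (A * Real.exp (-scaledBoundary A ^ 2)) + erf (scaledBoundary A)

theorem hasDerivAt_scaledBoundary {A : ℝ} (hA : 0 < A) :
    HasDerivAt scaledBoundary
      (-(3 * Real.sqrt (1 + 8 * A ^ 2) - 1) / (4 * A ^ 2 * Real.sqrt (1 + 8 * A ^ 2))) A := by
  have hpos : (0 : ℝ) < 1 + 8 * A ^ 2 := by positivity
  have hS : 0 < Real.sqrt (1 + 8 * A ^ 2) := Real.sqrt_pos.2 hpos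
  have hSsq := Real.sq_sqrt hpos.le
  have hinner : HasDerivAt (fun x : ℝ => 1 + 8 * x ^ 2) (16 * A) A := by
    refine (((hasDerivAt_pow 2 A).const_mul 8).const_add 1).congr_deriv ?_
    norm_num
    ring
  have hden : HasDerivAt (fun x : ℝ => 4 * x) 4 A := by
    simpa using (hasDerivAt_id A).const_mul (4 : ℝ)
  refine (((hinner.sqrt hpos.ne').const_sub 3).div hden (by positivity)).congr_deriv ?_
  set S := Real.sqrt (1 + 8 * A ^ 2)
  field_simp
  linear_combination 2 * hSsq

theorem hasDerivAt_scaledValue {A : ℝ} (hA : 0 < A) :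
    HasDerivAt scaledValue
      (((2 * A ^ 2 + 1) * Real.sqrt (1 + 8 * A ^ 2) - (6 * A ^ 2 + 1))
        * Real.exp (-scaledBoundary A ^ 2)
        / (Real.sqrt Real.pi * A ^ 2 * Real.sqrt (1 + 8 * A ^ 2))) A := by
  have hpos : (0 : ℝ) < 1 + 8 * A ^ 2 := by positivity
  have hS : 0 < Real.sqrt (1 + 8 * A ^ 2) := Real.sqrt_pos.2 hpos
  have hSsq := Real.sq_sqrt hpos.le
  have hπ : 0 < Real.sqrt Real.pi := Real.sqrt_pos.2 Real.pi_pos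
  have hb := hasDerivAt_scaledBoundary hA
  have hbA : scaledBoundary A * (4 * A) = 3 - Real.sqrt (1 + 8 * A ^ 2) :=
    div_mul_cancel₀ _ (by positivity)
  refine ((((hasDerivAt_id A).mul (hb.pow 2).neg.exp).const_mul (2 / Real.sqrt Real.pi)).add
    ((hasDerivAt_erf _).comp A hb)).congr_deriv ?_
  simp only [id, Pi.neg_apply, Pi.pow_apply]
  generalize scaledBoundary A = B at *
  generalize Real.sqrt (1 + 8 * A ^ 2) = S at *
  generalize Real.exp (-B ^ 2) = E at *
  have hB : B = (3 - S) / (4 * A) := by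
    rw [← hbA]
    field_simp
  subst hB
  norm_num
  field_simp
  linear_combination -12 * E * hSsq

theorem scaledValue_deriv_numerator_pos {A : ℝ} (hA : 0 < A) :
    0 < (2 * A ^ 2 + 1) * Real.sqrt (1 + 8 * A ^ 2) - (6 * A ^ 2 + 1) := by
  have hSsq := Real.sq_sqrt (show (0 : ℝ) ≤ 1 + 8 * A ^ 2 by positivity)
  have hsq : ((2 * A ^ 2 + 1) * Real.sqrt (1 + 8 * A ^ 2)) ^ 2 - (6 * A ^ 2 + 1) ^ 2
      = 32 * A ^ 6 := by
    linear_combination (2 * A ^ 2 + 1) ^ 2 * hSsq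
  have h6 : 0 < 32 * A ^ 6 := by positivity
  exact sub_pos.2 (lt_of_pow_lt_pow_left₀ 2 (by positivity) (by linarith))

/-- Fixing `σ, M > 0`, the map `r ↦ c(r)` is strictly increasing on `(0,∞)`;
in particular, with `A = σ√r/M`,
`∂c/∂r = ((2A²+1)√(1+8A²) − (6A²+1)) e^{−b²}/(2√π r A √(1+8A²)) > 0`. -/
theorem stmt_18 (σ M : ℝ) (hσ : 0 < σ) (hM : 0 < M)
    (a b c : ℝ → ℝ)
    (ha : ∀ r, a r = (1 / 2) * (Real.sqrt (1 + 8 * r * σ ^ 2 / M ^ 2) - 1))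
    (hb : ∀ r, b r = (1 - a r) * M / (2 * σ * Real.sqrt r))
    (hc : ∀ r, c r = (2 * σ * Real.sqrt r * Real.exp (-(b r) ^ 2))
      / (M * Real.sqrt Real.pi) + erf (b r)) :
    StrictMonoOn c (Set.Ioi 0) ∧
    (∀ r : ℝ, 0 < r → ∀ A : ℝ, A = σ * Real.sqrt r / M →
      HasDerivAt c
        (((2 * A ^ 2 + 1) * Real.sqrt (1 + 8 * A ^ 2) - (6 * A ^ 2 + 1))
          * Real.exp (-(b r) ^ 2)
          / (2 * Real.sqrt Real.pi * r * A * Real.sqrt (1 + 8 * A ^ 2))) r ∧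
      0 < ((2 * A ^ 2 + 1) * Real.sqrt (1 + 8 * A ^ 2) - (6 * A ^ 2 + 1))
          * Real.exp (-(b r) ^ 2)
          / (2 * Real.sqrt Real.pi * r * A * Real.sqrt (1 + 8 * A ^ 2))) := by
  have hderiv : ∀ r : ℝ, 0 < r → ∀ A : ℝ, A = σ * Real.sqrt r / M →
      HasDerivAt c
        (((2 * A ^ 2 + 1) * Real.sqrt (1 + 8 * A ^ 2) - (6 * A ^ 2 + 1))
          * Real.exp (-(b r) ^ 2)
          / (2 * Real.sqrt Real.pi * r * A * Real.sqrt (1 + 8 * A ^ 2))) r ∧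
      0 < ((2 * A ^ 2 + 1) * Real.sqrt (1 + 8 * A ^ 2) - (6 * A ^ 2 + 1))
          * Real.exp (-(b r) ^ 2)
          / (2 * Real.sqrt Real.pi * r * A * Real.sqrt (1 + 8 * A ^ 2)) := by
    intro r hr A hA
    have hApos : 0 < A := by
      rw [hA]
      positivity
    have hπ : 0 < Real.sqrt Real.pi := Real.sqrt_pos.2 Real.pi_pos
    have hbs : ∀ x, 0 < x → b x = scaledBoundary (σ * Real.sqrt x / M) := by
      intro x hx
      have hsq : 8 * x * σ ^ 2 / M ^ 2 = 8 * (σ * Real.sqrt x / M) ^ 2 := by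
        rw [div_pow, mul_pow, Real.sq_sqrt hx.le]
        ring
      rw [hb, ha, scaledBoundary, hsq]
      have hx' := Real.sqrt_pos.2 hx
      field_simp
      ring
    have hcs : ∀ x, 0 < x → c x = scaledValue (σ * Real.sqrt x / M) := by
      intro x hx
      rw [hc, scaledValue, ← hbs x hx]
      field_simp
    have hdA : HasDerivAt (fun x => σ * Real.sqrt x / M) (A / (2 * r)) r := by
      refine (((Real.hasDerivAt_sqrt hr.ne').const_mul σ).div_const M).congr_deriv ?_
      have hr' := Real.sqrt_pos.2 hr
      rw [hA]
      field_simp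
      rw [Real.sq_sqrt hr.le]
    refine ⟨?_, div_pos (mul_pos (scaledValue_deriv_numerator_pos hApos) (Real.exp_pos _))
      (by positivity)⟩
    have hcomp := (hA ▸ hasDerivAt_scaledValue hApos :
      HasDerivAt scaledValue _ (σ * Real.sqrt r / M)).comp r hdA
    refine (hcomp.congr_of_eventuallyEq ?_).congr_deriv ?_
    · filter_upwards [lt_mem_nhds hr] with x hx using hcs x hx
    · rw [hbs r hr, ← hA]
      field_simp
  refine ⟨?_, hderiv⟩
  refine strictMonoOn_of_deriv_pos (convex_Ioi 0)
    (fun x hx => (hderiv x hx _ rfl).1.continuousAt.continuousWithinAt) fun x hx => ?_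
  rw [interior_Ioi] at hx
  rw [(hderiv x hx _ rfl).1.deriv]
  exact (hderiv x hx _ rfl).2
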